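/- arXiv:2501.15621 — 4 statements merged into one kernel-verified Lean document; each statement's English description precedes it below -/
import Mathlib

section
/- Let u₁, u₂, u₃ ∈ ℝ with u₁ ≥ u₂ > u₃ and u₁ + u₂ + 2u₃ = 0, and set u₄ := u₃. Define c := −(u₁u₂ + u₁u₃ + u₁u₄ + u₂u₃ + u₂u₄ + u₃u₄), b := (u₁u₂u₃ + u₁u₂u₄ + u₁u₃u₄ + u₂u₃u₄)/2, d := −u₁u₂u₃u₄, and ν := (1/2)√((u₁−u₃)(u₂−u₃)). Then the function U(x) := u₃ + (u₁−u₃)(u₂−u₃) / ((u₂−u₃) + (u₁−u₂) sin²(νx)) is well defined (the denominator is positive) and differentiable on ℝ, and satisfies the first-order invariant (U'(x))² + U(x)⁴ − c U(x)² − 2b U(x) = d for all x ∈ ℝ. -/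
/-- The trigonometric degenerate waveform (coalescing roots `u₄ = u₃`)
satisfies the first-order invariant `(U')² + U⁴ - cU² - 2bU = d`. -/
theorem mkdv_trigonometric_waveform_invariant
    (u₁ u₂ u₃ u₄ c b d ν : ℝ)
    (h12 : u₂ ≤ u₁) (h23 : u₃ < u₂)
    (h4 : u₄ = u₃)
    (hsum : u₁ + u₂ + 2 * u₃ = 0)
    (hc : c = -(u₁*u₂ + u₁*u₃ + u₁*u₄ + u₂*u₃ + u₂*u₄ + u₃*u₄))
    (hb : b = (u₁*u₂*u₃ + u₁*u₂*u₄ + u₁*u₃*u₄ + u₂*u₃*u₄) / 2)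
    (hd : d = -(u₁*u₂*u₃*u₄))
    (hν : ν = (1/2) * Real.sqrt ((u₁ - u₃) * (u₂ - u₃)))
    (U : ℝ → ℝ)
    (hU : ∀ x : ℝ, U x = u₃ + (u₁ - u₃) * (u₂ - u₃) /
      ((u₂ - u₃) + (u₁ - u₂) * (Real.sin (ν * x))^2)) :
    (∀ x : ℝ, 0 < (u₂ - u₃) + (u₁ - u₂) * (Real.sin (ν * x))^2) ∧
    Differentiable ℝ U ∧
    ∀ x : ℝ, (deriv U x)^2 + (U x)^4 - c * (U x)^2 - 2 * b * U x = d := by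
  have hpq : 0 < (u₁ - u₃) * (u₂ - u₃) := mul_pos (by linarith) (by linarith)
  have hpos : ∀ x : ℝ, 0 < (u₂ - u₃) + (u₁ - u₂) * (Real.sin (ν * x))^2 := fun x =>
    add_pos_of_pos_of_nonneg (by linarith) (mul_nonneg (by linarith) (sq_nonneg _))
  have hν2 : 4 * ν ^ 2 = (u₁ - u₃) * (u₂ - u₃) := by
    rw [hν, mul_pow, Real.sq_sqrt hpq.le]
    ring
  have hderiv : ∀ x : ℝ, HasDerivAt U
      (-((u₁ - u₃) * (u₂ - u₃) * ((u₁ - u₂) * (2 * Real.sin (ν * x) * (Real.cos (ν * x) * ν)))) /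
        ((u₂ - u₃) + (u₁ - u₂) * (Real.sin (ν * x))^2) ^ 2) x := by
    intro x
    have hsin : HasDerivAt (fun y => Real.sin (ν * y)) (Real.cos (ν * x) * ν) x := by
      simpa using ((hasDerivAt_id x).const_mul ν).sin
    have hden := ((hsin.pow 2).const_mul (u₁ - u₂)).const_add (u₂ - u₃)
    rw [funext hU]
    refine (((hasDerivAt_const x ((u₁ - u₃) * (u₂ - u₃))).div hden
      (hpos x).ne').const_add u₃).congr_deriv ?_
    simp
  refine ⟨hpos, fun x => (hderiv x).differentiableAt, fun x => ?_⟩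
  have hfactor : (deriv U x) ^ 2 = -((U x - u₁) * (U x - u₂) * (U x - u₃) ^ 2) := by
    rw [(hderiv x).deriv, hU x]
    have hD := (hpos x).ne'
    have hcos := Real.cos_sq' (ν * x)
    generalize Real.sin (ν * x) = s at *
    generalize Real.cos (ν * x) = k at *
    obtain ⟨D, hDs⟩ : ∃ D, D = (u₂ - u₃) + (u₁ - u₂) * s ^ 2 := ⟨_, rfl⟩
    rw [← hDs] at hD ⊢
    have h₁ : u₃ + (u₁ - u₃) * (u₂ - u₃) / D - u₁ = -((u₁ - u₃) * (u₁ - u₂) * s ^ 2) / D := by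
      field_simp
      rw [hDs]
      ring
    have h₂ : u₃ + (u₁ - u₃) * (u₂ - u₃) / D - u₂ = (u₂ - u₃) * (u₁ - u₂) * k ^ 2 / D := by
      field_simp
      rw [hDs, hcos]
      ring
    rw [h₁, h₂]
    field_simp
    linear_combination ((u₁ - u₃) * (u₂ - u₃) * (u₁ - u₂) * s * k) ^ 2 * hν2
  rw [hc, hb, hd, h4]
  linear_combination hfactor + (U x) ^ 3 * hsum
end

section
/- Let u₁, u₂, u₄ ∈ ℝ with u₄ < u₂ < u₁ and u₁ + 2u₂ + u₄ = 0, and set u₃ := u₂. Define c := −(u₁u₂ + u₁u₃ + u₁u₄ + u₂u₃ + u₂u₄ + u₃u₄), b := (u₁u₂u₃ + u₁u₂u₄ + u₁u₃u₄ + u₂u₃u₄)/2, d := −u₁u₂u₃u₄, and ν := (1/2)√((u₁−u₂)(u₂−u₄)). Then the function U(x) := u₄ + (u₁−u₄)(u₂−u₄) / ((u₂−u₄) + (u₁−u₂) tanh²(νx)) is well defined (the denominator is positive) and differentiable on ℝ, and satisfies the first-order invariant (U'(x))² + U(x)⁴ − c U(x)² − 2b U(x) = d for all x ∈ ℝ.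 -/
/-- The hyperbolic tangent solves the Riccati equation `t' = 1 - t²`. -/
theorem hasDerivAt_real_tanh (x : ℝ) : HasDerivAt Real.tanh (1 - Real.tanh x ^ 2) x := by
  have hcosh : Real.cosh x ≠ 0 := (Real.cosh_pos x).ne'
  have hquot := (Real.hasDerivAt_sinh x).div (Real.hasDerivAt_cosh x) hcosh
  have htanh : Real.tanh = Real.sinh / Real.cosh := funext Real.tanh_eq_sinh_div_cosh
  rw [htanh]
  refine hquot.congr_deriv ?_
  simp only [Pi.div_apply]
  field_simp

/-- The derivative of `x ↦ u + A / (q + p tanh² (νx))`. -/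
theorem hasDerivAt_add_div_tanh_sq (u A p q ν x : ℝ)
    (hD : q + p * Real.tanh (ν * x) ^ 2 ≠ 0) :
    HasDerivAt (fun y => u + A / (q + p * Real.tanh (ν * y) ^ 2))
      (-(2 * A * p * ν * Real.tanh (ν * x) * (1 - Real.tanh (ν * x) ^ 2)) /
        (q + p * Real.tanh (ν * x) ^ 2) ^ 2) x := by
  have hlin : HasDerivAt (fun y => ν * y) ν x := by
    simpa using (hasDerivAt_id x).const_mul ν
  have htanh : HasDerivAt (fun y => Real.tanh (ν * y))
      ((1 - Real.tanh (ν * x) ^ 2) * ν) x :=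
    (hasDerivAt_real_tanh (ν * x)).comp x hlin
  refine (((hasDerivAt_const x A).div
    (((htanh.pow 2).const_mul p).const_add q) hD).const_add u).congr_deriv ?_
  simp only [Pi.pow_apply]
  ring

/-- The first hyperbolic (solitary-wave) degenerate waveform (coalescing roots
`u₃ = u₂`) satisfies the first-order invariant `(U')² + U⁴ - cU² - 2bU = d`. -/
theorem mkdv_hyperbolic_waveform_invariant
    (u₁ u₂ u₃ u₄ c b d ν : ℝ)
    (h42 : u₄ < u₂) (h21 : u₂ < u₁)
    (h3 : u₃ = u₂)
    (hsum : u₁ + 2 * u₂ + u₄ = 0)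
    (hc : c = -(u₁*u₂ + u₁*u₃ + u₁*u₄ + u₂*u₃ + u₂*u₄ + u₃*u₄))
    (hb : b = (u₁*u₂*u₃ + u₁*u₂*u₄ + u₁*u₃*u₄ + u₂*u₃*u₄) / 2)
    (hd : d = -(u₁*u₂*u₃*u₄))
    (hν : ν = (1/2) * Real.sqrt ((u₁ - u₂) * (u₂ - u₄)))
    (U : ℝ → ℝ)
    (hU : ∀ x : ℝ, U x = u₄ + (u₁ - u₄) * (u₂ - u₄) /
      ((u₂ - u₄) + (u₁ - u₂) * (Real.tanh (ν * x))^2)) :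
    (∀ x : ℝ, 0 < (u₂ - u₄) + (u₁ - u₂) * (Real.tanh (ν * x))^2) ∧
    Differentiable ℝ U ∧
    ∀ x : ℝ, (deriv U x)^2 + (U x)^4 - c * (U x)^2 - 2 * b * U x = d := by
  have hp : 0 < u₁ - u₂ := sub_pos.2 h21
  have hq : 0 < u₂ - u₄ := sub_pos.2 h42
  have hD : ∀ x : ℝ, 0 < (u₂ - u₄) + (u₁ - u₂) * (Real.tanh (ν * x))^2 := fun x => by positivity
  have hderiv := fun x : ℝ =>
    hasDerivAt_add_div_tanh_sq u₄ ((u₁ - u₄) * (u₂ - u₄)) (u₁ - u₂) (u₂ - u₄) ν x (hD x).ne'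
  rw [← funext hU] at hderiv
  refine ⟨hD, fun x => (hderiv x).differentiableAt, fun x => ?_⟩
  have hν_sq : 4 * ν ^ 2 = (u₁ - u₂) * (u₂ - u₄) := by
    rw [hν, mul_pow, Real.sq_sqrt (mul_pos hp hq).le]
    ring
  have hfactor : (U x)^4 - c * (U x)^2 - 2 * b * U x - d =
      (U x - u₁) * (U x - u₂) ^ 2 * (U x - u₄) := by
    rw [hc, hb, hd, h3]
    linear_combination (U x) ^ 3 * hsum
  suffices h : (deriv U x)^2 + (U x - u₁) * (U x - u₂) ^ 2 * (U x - u₄) = 0 by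
    linear_combination h + hfactor
  rw [(hderiv x).deriv, hU x]
  have hDx := (hD x).ne'
  generalize Real.tanh (ν * x) = t at hDx ⊢
  generalize hD_def : (u₂ - u₄) + (u₁ - u₂) * t ^ 2 = D at hDx ⊢
  have h₁ : u₄ + (u₁ - u₄) * (u₂ - u₄) / D - u₁ = -((u₁ - u₄) * (u₁ - u₂) * t ^ 2) / D := by
    field_simp
    rw [← hD_def]
    ring
  have h₂ : u₄ + (u₁ - u₄) * (u₂ - u₄) / D - u₂ =
      (u₁ - u₂) * (u₂ - u₄) * (1 - t ^ 2) / D := by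
    field_simp
    rw [← hD_def]
    ring
  rw [h₁, h₂, add_sub_cancel_left]
  linear_combination
    ((u₁ - u₄) * (u₂ - u₄) * (u₁ - u₂) * t * (1 - t ^ 2)) ^ 2 / D ^ 4 * hν_sq
end

section
/- Let c, b ∈ ℝ, let U : ℝ → ℝ be twice differentiable with U''(x) + 2U(x)³ − cU(x) = b for all x, let λ, Ω ∈ ℂ, and let p, q : ℝ → ℂ be differentiable functions satisfying, for all x ∈ ℝ: p' = λp + Uq, q' = −Up − λq, Ω p = (−4λ³ − 2λU² + cλ) p − (4λ²U + 2U³ + U'' − cU + 2λU') q, and Ω q = (4λ²U + 2U³ + U'' − cU − 2λU') p + (4λ³ + 2λU² − cλ) q. Then the function 𝔲 := p² − q² is three times differentiable and satisfies 𝔲'''(x) + 12 U(x)U'(x) 𝔲(x) + 6U(x)² 𝔲'(x) − c 𝔲'(x) = −2Ω 𝔲(x) for all x ∈ ℝ; equivalently, Λ 𝔲 + 𝔲''' + 6(U²𝔲)' − c𝔲' = 0 with Λ = 2Ω. -/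
/-- Squared-eigenfunction relation: if `(p,q)` solves the Lax system at a
traveling wave `U`, then `𝔲 = p² - q²` solves the linearized mKdV equation
`Λ𝔲 + 𝔲''' + 6(U²𝔲)' - c𝔲' = 0` with `Λ = 2Ω`, i.e.
`𝔲''' + 12UU'𝔲 + 6U²𝔲' - c𝔲' = -2Ω𝔲`. -/
theorem mkdv_squared_eigenfunction
    (c b : ℝ) (U : ℝ → ℝ)
    (hU1 : Differentiable ℝ U)
    (hU2 : Differentiable ℝ (deriv U))
    (hUb : ∀ x : ℝ, deriv (deriv U) x + 2 * (U x)^3 - c * U x = b)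
    (lam Ω : ℂ) (p q : ℝ → ℂ)
    (hp : Differentiable ℝ p) (hq : Differentiable ℝ q)
    (hp' : ∀ x : ℝ, deriv p x = lam * p x + (U x : ℂ) * q x)
    (hq' : ∀ x : ℝ, deriv q x = -(U x : ℂ) * p x - lam * q x)
    (hΩp : ∀ x : ℝ, Ω * p x =
      (-4*lam^3 - 2*lam*(U x : ℂ)^2 + (c:ℂ)*lam) * p x
        - (4*lam^2*(U x : ℂ) + 2*(U x : ℂ)^3 + ((deriv (deriv U) x : ℝ) : ℂ)
            - (c:ℂ)*(U x : ℂ) + 2*lam*((deriv U x : ℝ) : ℂ)) * q x)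
    (hΩq : ∀ x : ℝ, Ω * q x =
      (4*lam^2*(U x : ℂ) + 2*(U x : ℂ)^3 + ((deriv (deriv U) x : ℝ) : ℂ)
            - (c:ℂ)*(U x : ℂ) - 2*lam*((deriv U x : ℝ) : ℂ)) * p x
        + (4*lam^3 + 2*lam*(U x : ℂ)^2 - (c:ℂ)*lam) * q x) :
    Differentiable ℝ (fun x : ℝ => (p x)^2 - (q x)^2) ∧
    Differentiable ℝ (deriv (fun x : ℝ => (p x)^2 - (q x)^2)) ∧
    Differentiable ℝ (deriv (deriv (fun x : ℝ => (p x)^2 - (q x)^2))) ∧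
    ∀ x : ℝ,
      deriv^[3] (fun y : ℝ => (p y)^2 - (q y)^2) x
        + 12 * (U x : ℂ) * ((deriv U x : ℝ) : ℂ) * ((p x)^2 - (q x)^2)
        + 6 * (U x : ℂ)^2 * deriv (fun y : ℝ => (p y)^2 - (q y)^2) x
        - (c:ℂ) * deriv (fun y : ℝ => (p y)^2 - (q y)^2) x
      = -2 * Ω * ((p x)^2 - (q x)^2) := by
  have hP (x : ℝ) : HasDerivAt p (lam * p x + (U x : ℂ) * q x) x :=
    hp' x ▸ (hp x).hasDerivAt
  have hQ (x : ℝ) : HasDerivAt q (-(U x : ℂ) * p x - lam * q x) x :=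
    hq' x ▸ (hq x).hasDerivAt
  have hU (x : ℝ) : HasDerivAt (fun y : ℝ => (U y : ℂ)) ((deriv U x : ℝ) : ℂ) x :=
    (hU1 x).hasDerivAt.ofReal_comp
  have hV (x : ℝ) : HasDerivAt (fun y : ℝ => ((deriv U y : ℝ) : ℂ))
      ((deriv (deriv U) x : ℝ) : ℂ) x :=
    (hU2 x).hasDerivAt.ofReal_comp
  have hdiff (x : ℝ) : HasDerivAt (fun y : ℝ => (p y)^2 - (q y)^2)
      (2 * lam * ((p x)^2 + (q x)^2) + 4 * ((U x : ℂ) * (p x * q x))) x := by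
    refine (((hP x).pow 2).sub ((hQ x).pow 2)).congr_deriv ?_
    push_cast
    ring
  have hsum (x : ℝ) : HasDerivAt (fun y : ℝ => (p y)^2 + (q y)^2)
      (2 * lam * ((p x)^2 - (q x)^2)) x := by
    refine (((hP x).pow 2).add ((hQ x).pow 2)).congr_deriv ?_
    push_cast
    ring
  have hprod (x : ℝ) : HasDerivAt (fun y : ℝ => p y * q y)
      (-(U x : ℂ) * ((p x)^2 - (q x)^2)) x := by
    refine ((hP x).mul (hQ x)).congr_deriv ?_
    ring
  have hderiv1 : deriv (fun y : ℝ => (p y)^2 - (q y)^2) =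
      fun x => 2 * lam * ((p x)^2 + (q x)^2) + 4 * ((U x : ℂ) * (p x * q x)) :=
    funext fun x => (hdiff x).deriv
  have hdiff2 (x : ℝ) : HasDerivAt
      (fun x : ℝ => 2 * lam * ((p x)^2 + (q x)^2) + 4 * ((U x : ℂ) * (p x * q x)))
      (4 * lam^2 * ((p x)^2 - (q x)^2) + 4 * (((deriv U x : ℝ) : ℂ) * (p x * q x))
        - 4 * ((U x : ℂ)^2 * ((p x)^2 - (q x)^2))) x := by
    refine (((hsum x).const_mul (2 * lam)).add (((hU x).mul (hprod x)).const_mul 4)).congr_deriv ?_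
    ring
  have hderiv2 : deriv (deriv (fun y : ℝ => (p y)^2 - (q y)^2)) =
      fun x => 4 * lam^2 * ((p x)^2 - (q x)^2) + 4 * (((deriv U x : ℝ) : ℂ) * (p x * q x))
        - 4 * ((U x : ℂ)^2 * ((p x)^2 - (q x)^2)) := by
    rw [hderiv1]
    exact funext fun x => (hdiff2 x).deriv
  have hdiff3 (x : ℝ) := (((hdiff x).const_mul (4 * lam^2)).add
    (((hV x).mul (hprod x)).const_mul 4)).sub ((((hU x).pow 2).mul (hdiff x)).const_mul 4)
  refine ⟨fun x => (hdiff x).differentiableAt, ?_, ?_, fun x => ?_⟩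
  · rw [hderiv1]
    exact fun x => (hdiff2 x).differentiableAt
  · rw [hderiv2]
    exact fun x => (hdiff3 x).differentiableAt
  · have hderiv3 : deriv^[3] (fun y : ℝ => (p y)^2 - (q y)^2) x = _ :=
      (congrArg (fun f => deriv f x) hderiv2).trans (hdiff3 x).deriv
    rw [hderiv3, hderiv1]
    simp only [Pi.pow_apply]
    push_cast
    linear_combination 2 * p x * hΩp x - 2 * q x * hΩq x
end

section
/- Let λ₁, λ₂, λ₃ ∈ ℝ with 0 ≤ |λ₃| ≤ λ₂ ≤ λ₁, and define P(λ) := 16(λ² − λ₁²)(λ² − λ₂²)(λ² − λ₃²) for λ ∈ ℂ. Let S ⊂ ℂ be the union of the imaginary axis {λ ∈ ℂ : Re λ = 0} and the real segments [−λ₁, −λ₂], [−|λ₃|, |λ₃|], [λ₂, λ₁] (regarded as subsets of ℂ). Then {Λ ∈ ℂ : ∃ λ ∈ S, Λ² = 4P(λ)} = {Λ ∈ ℂ : Re Λ = 0}, the imaginary axis. -/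
/-- A complex number whose square is a nonpositive real is purely imaginary. -/
lemma Complex.re_eq_zero_of_sq_eq_nonpos {z : ℂ} {r : ℝ} (hr : r ≤ 0) (h : z ^ 2 = (r : ℂ)) :
    z.re = 0 := by
  have hre := congrArg Complex.re h
  have him := congrArg Complex.im h
  simp only [pow_two, Complex.mul_re, Complex.mul_im, Complex.ofReal_re, Complex.ofReal_im]
    at hre him
  have hmul : z.re * z.im = 0 := by linarith
  rcases mul_eq_zero.mp hmul with h0 | h0
  · exact h0
  · rw [h0] at hre
    nlinarith [sq_nonneg z.re]

/-- A purely imaginary number squares to minus the square of its imaginary part. -/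
lemma Complex.sq_eq_of_re_eq_zero {z : ℂ} (h : z.re = 0) : z ^ 2 = ((-z.im ^ 2 : ℝ) : ℂ) := by
  apply Complex.ext
  · simp [pow_two, h]
  · simp [pow_two, h]

/-- A cubic with ordered roots `c ≤ b ≤ a` is nonpositive on `(-∞, c] ∪ [b, a]`. -/
lemma cubic_nonpos {a b c t : ℝ} (hcb : c ≤ b) (hba : b ≤ a) (ht : t ≤ c ∨ b ≤ t ∧ t ≤ a) :
    64 * ((t - a) * (t - b) * (t - c)) ≤ 0 := by
  rcases ht with ht | ⟨hbt, hta⟩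
  · have := mul_nonneg_of_nonpos_of_nonpos (by linarith : t - a ≤ 0) (by linarith : t - b ≤ 0)
    nlinarith [mul_nonpos_of_nonneg_of_nonpos this (by linarith : t - c ≤ 0)]
  · have := mul_nonpos_of_nonpos_of_nonneg (by linarith : t - a ≤ 0) (by linarith : 0 ≤ t - b)
    nlinarith [mul_nonpos_of_nonpos_of_nonneg this (by linarith : 0 ≤ t - c)]

/-- A cubic with ordered roots `0 ≤ c ≤ b ≤ a` takes every nonpositive value on `(-∞, c]`. -/
lemma exists_le_cubic_eq {a b c r : ℝ} (hc : 0 ≤ c) (hcb : c ≤ b) (hba : b ≤ a) (hr : r ≤ 0) :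
    ∃ t ≤ c, 64 * ((t - a) * (t - b) * (t - c)) = r := by
  have hcont : ContinuousOn (fun t : ℝ => 64 * ((t - a) * (t - b) * (t - c)))
      (Set.Icc (r - 1) c) := by fun_prop
  have hlow : 64 * ((r - 1 - a) * (r - 1 - b) * (r - 1 - c)) ≤ r := by
    have h₁ : 1 ≤ (a + 1 - r) * (b + 1 - r) :=
      one_le_mul_of_one_le_of_one_le (by linarith) (by linarith)
    have h₂ : c + 1 - r ≤ (a + 1 - r) * (b + 1 - r) * (c + 1 - r) :=
      le_mul_of_one_le_left (by linarith) h₁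
    have h₃ : (r - 1 - a) * (r - 1 - b) * (r - 1 - c)
        = -((a + 1 - r) * (b + 1 - r) * (c + 1 - r)) := by ring
    linarith
  obtain ⟨t, ht, hval⟩ := intermediate_value_Icc (by linarith) hcont
    (show r ∈ Set.Icc _ _ from ⟨hlow, by simpa using hr⟩)
  exact ⟨t, ht.2, hval⟩

/-- Theorem 1 of the paper (spectral stability of the dnoidal-type waveform):
the image of the Lax spectrum
`S = iℝ ∪ [-λ₁,-λ₂] ∪ [-|λ₃|,|λ₃|] ∪ [λ₂,λ₁]` under `Λ = ±2√P(λ)` (i.e. the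
set of `Λ` with `Λ² = 4P(λ)` for some `λ ∈ S`) is exactly the imaginary axis. -/
theorem mkdv_dnoidal_stability_spectrum
    (lam₁ lam₂ lam₃ : ℝ)
    (h32 : |lam₃| ≤ lam₂) (h21 : lam₂ ≤ lam₁)
    (P : ℂ → ℂ)
    (hP : ∀ l : ℂ, P l = 16*(l^2 - (lam₁:ℂ)^2)*(l^2 - (lam₂:ℂ)^2)*(l^2 - (lam₃:ℂ)^2))
    (S : Set ℂ)
    (hS : S = {l : ℂ | l.re = 0}
        ∪ (fun x : ℝ => (x : ℂ)) '' Set.Icc (-lam₁) (-lam₂)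
        ∪ (fun x : ℝ => (x : ℂ)) '' Set.Icc (-|lam₃|) |lam₃|
        ∪ (fun x : ℝ => (x : ℂ)) '' Set.Icc lam₂ lam₁) :
    {Λ : ℂ | ∃ l ∈ S, Λ^2 = 4 * P l} = {Λ : ℂ | Λ.re = 0} := by
  have hc : (0 : ℝ) ≤ lam₃ ^ 2 := sq_nonneg _
  have h2 : 0 ≤ lam₂ := (abs_nonneg _).trans h32
  have hcb : lam₃ ^ 2 ≤ lam₂ ^ 2 := sq_le_sq' (by linarith [neg_abs_le lam₃])
    ((le_abs_self _).trans h32)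
  have hba : lam₂ ^ 2 ≤ lam₁ ^ 2 := pow_le_pow_left₀ h2 h21 2
  have hval : ∀ (l : ℂ) (t : ℝ), l ^ 2 = (t : ℂ) → 4 * P l
      = ((64 * ((t - lam₁ ^ 2) * (t - lam₂ ^ 2) * (t - lam₃ ^ 2)) : ℝ) : ℂ) := by
    intro l t h
    rw [hP, h]
    push_cast
    ring
  ext Λ
  simp only [Set.mem_ofPred_eq]
  constructor
  · rintro ⟨l, hl, hΛ⟩
    obtain ⟨t, hlt, ht⟩ : ∃ t : ℝ, l ^ 2 = (t : ℂ) ∧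
        (t ≤ lam₃ ^ 2 ∨ lam₂ ^ 2 ≤ t ∧ t ≤ lam₁ ^ 2) := by
      rw [hS] at hl
      rcases hl with ((hl | ⟨x, hx, rfl⟩) | ⟨x, hx, rfl⟩) | ⟨x, hx, rfl⟩
      · exact ⟨_, Complex.sq_eq_of_re_eq_zero hl, Or.inl (by nlinarith [sq_nonneg l.im])⟩
      · exact ⟨x ^ 2, by push_cast; rfl,
          Or.inr ⟨by nlinarith [hx.1, hx.2], by nlinarith [hx.1, hx.2]⟩⟩
      · exact ⟨x ^ 2, by push_cast; rfl, Or.inl (sq_le_sq.mpr (abs_le.mpr hx))⟩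
      · exact ⟨x ^ 2, by push_cast; rfl,
          Or.inr ⟨by nlinarith [hx.1, hx.2], by nlinarith [hx.1, hx.2]⟩⟩
    exact Complex.re_eq_zero_of_sq_eq_nonpos (cubic_nonpos hcb hba ht) (hΛ.trans (hval l t hlt))
  · intro hΛ
    obtain ⟨t, htc, ht⟩ := exists_le_cubic_eq hc hcb hba
      (neg_nonpos.mpr (sq_nonneg Λ.im))
    obtain ⟨l, hl, hlt⟩ : ∃ l ∈ S, l ^ 2 = (t : ℂ) := by
      rw [hS]
      rcases le_total 0 t with h0 | h0
      · refine ⟨(√t : ℝ), Or.inl (Or.inr ⟨√t, ⟨?_, ?_⟩, rfl⟩), ?_⟩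
        · linarith [Real.sqrt_nonneg t, abs_nonneg lam₃]
        · exact Real.sqrt_le_iff.mpr ⟨abs_nonneg _, by rwa [sq_abs]⟩
        · rw [← Complex.ofReal_pow, Real.sq_sqrt h0]
      · have hre : ((√(-t) : ℝ) * Complex.I).re = 0 := by simp
        refine ⟨(√(-t) : ℝ) * Complex.I, Or.inl (Or.inl (Or.inl hre)), ?_⟩
        rw [mul_pow, Complex.I_sq, ← Complex.ofReal_pow, Real.sq_sqrt (by linarith)]
        push_cast
        ring
    exact ⟨l, hl, by rw [hval l t hlt, ht, Complex.sq_eq_of_re_eq_zero hΛ]⟩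
end
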